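/- (Approximate additivity.) Let 0 < ε < 1. For any s, t ∈ S and a, b, c, d ∈ A such that d((s, a), (t, c)) ≤ ε and d((s, b), (t, d)) ≤ ε, one has d((s, a + b), (t, c + d)) ≤ ε · max over 1 ≤ i ≤ m of max(1, |s|ᵢ⁻¹|a|ᵢ, |s|ᵢ⁻¹|b|ᵢ, |t|ᵢ⁻¹|c|ᵢ, |t|ᵢ⁻¹|d|ᵢ). -/

import Mathlib

/-- A multiplicative nonarchimedean norm on a (possibly noncommutative) unital ring. -/
def IsMultNorm {A : Type*} [Ring A] (f : A → ℝ) : Prop :=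
  (∀ a, 0 ≤ f a) ∧ (∀ a, f a = 0 ↔ a = 0) ∧
  (∀ a b, f (a + b) ≤ max (f a) (f b)) ∧ f 1 = 1 ∧
  (∀ a b, f (a * b) = f a * f b)

/-- A quasi-abelian multiplicative norm: `|ab - ba| ≤ γ·|ab|` for some `0 < γ < 1`. -/
def IsQuasiAbelian {A : Type*} [Ring A] (f : A → ℝ) : Prop :=
  IsMultNorm f ∧ ∃ γ : ℝ, 0 < γ ∧ γ < 1 ∧ ∀ a b, f (a * b - b * a) ≤ γ * f (a * b)

/-- The saturation of `S` with respect to the norm `f`. -/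
def Sat {A : Type*} [Ring A] (f : A → ℝ) (S : Set A) : Set A :=
  {a | ∃ s ∈ S, ∃ t ∈ S, f (a * t - s) < f s}

/-- `Δ(x,y) = |s|⁻¹·|t|⁻¹·|at − sb|` for `x = (s,a)`, `y = (t,b)`. -/
noncomputable def Delta {A : Type*} [Ring A] (f : A → ℝ) (x y : A × A) : ℝ :=
  (f x.1)⁻¹ * (f y.1)⁻¹ * f (x.2 * y.1 - x.1 * y.2)

/-- `dᵢ(x,y)` : the infimum over `ξ ∈ Sᵢ × A` of `max(Δᵢ(x,ξ), Δᵢ(y,ξ))`. -/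
noncomputable def dI {A : Type*} [Ring A] (f : A → ℝ) (S : Set A) (x y : A × A) : ℝ :=
  sInf {r : ℝ | ∃ ξ : A × A, ξ.1 ∈ Sat f S ∧ r = max (Delta f x ξ) (Delta f y ξ)}

/-- `d(x,y) = maxᵢ dᵢ(x,y)`. -/
noncomputable def dGlob {A : Type*} [Ring A] {m : ℕ} (f : Fin m → A → ℝ)
    (S : Set A) (x y : A × A) : ℝ :=
  ⨆ i : Fin m, dI (f i) S x y

namespace IsMultNorm

variable {A : Type*} [Ring A] {f : A → ℝ}

theorem map_neg (hf : IsMultNorm f) (a : A) : f (-a) = f a := by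
  obtain ⟨h0, -, -, h1, hmul⟩ := hf
  have h : f (-1) * f (-1) = 1 := by rw [← hmul]; simpa using h1
  have h' : f (-1) = 1 := by nlinarith [h0 (-1)]
  rw [← neg_one_mul, hmul, h', one_mul]

theorem map_sub_le_max (hf : IsMultNorm f) (x y z : A) :
    f (x - z) ≤ max (f (x - y)) (f (y - z)) := by
  have h := hf.2.2.1 (x - y) (y - z)
  rwa [sub_add_sub_cancel] at h

/-- In an ultrametric norm, elements at relative distance less than one have the same norm. -/
theorem map_eq_of_map_sub_lt (hf : IsMultNorm f) {x y : A} (h : f (x - y) < f y) :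
    f x = f y := by
  apply le_antisymm
  · have := hf.2.2.1 (x - y) y
    rw [sub_add_cancel, max_eq_right h.le] at this
    exact this
  · have := hf.2.2.1 (-(x - y)) x
    rw [hf.map_neg, neg_sub, sub_add_cancel] at this
    rcases le_max_iff.1 this with h' | h'
    · linarith
    · exact h'

theorem map_sub_lt_trans (hf : IsMultNorm f) {x y z : A} (h₁ : f (x - y) < f y)
    (h₂ : f (y - z) < f z) : f (x - z) < f z :=
  (hf.map_sub_le_max x y z).trans_lt (max_lt (hf.map_eq_of_map_sub_lt h₂ ▸ h₁) h₂)

theorem map_mul_sub_mul_lt (hf : IsMultNorm f) {x y x' y' : A} (h : f (x - y) < f y)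
    (h' : f (x' - y') < f y') : f (x * x' - y * y') < f (y * y') := by
  have hx' := hf.map_eq_of_map_sub_lt h'
  have hy : 0 < f y := (hf.1 _).trans_lt h
  have hy' : 0 < f y' := (hf.1 _).trans_lt h'
  have key : x * x' - y * y' = (x - y) * x' + y * (x' - y') := by noncomm_ring
  rw [key]
  refine (hf.2.2.1 _ _).trans_lt (max_lt ?_ ?_)
  · rw [hf.2.2.2.2, hf.2.2.2.2, hx']
    exact mul_lt_mul_of_pos_right h hy'
  · rw [hf.2.2.2.2, hf.2.2.2.2]
    exact mul_lt_mul_of_pos_left h' hy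

theorem pos_of_mem_sat (hf : IsMultNorm f) {S : Set A} {p : A} (hp : p ∈ Sat f S) : 0 < f p := by
  obtain ⟨s, -, t, -, h⟩ := hp
  have hpt := hf.map_eq_of_map_sub_lt h
  rw [hf.2.2.2.2] at hpt
  refine (hf.1 p).lt_of_ne fun h0 => ?_
  rw [← h0, zero_mul] at hpt
  exact absurd h (by rw [← hpt]; exact not_lt.2 (hf.1 _))

theorem one_mem_sat (hf : IsMultNorm f) {S : Set A} (h1S : (1 : A) ∈ S) : (1 : A) ∈ Sat f S :=
  ⟨1, h1S, 1, h1S, by simp [(hf.2.1 0).2 rfl, hf.2.2.2.1]⟩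

theorem mem_sat_of_map_sub_lt (hf : IsMultNorm f) {S : Set A} {x p : A} (hp : p ∈ Sat f S)
    (h : f (x - p) < f p) : x ∈ Sat f S := by
  obtain ⟨s, hs, t, ht, hst⟩ := hp
  have hpt : 0 < f (p * t) := by
    rw [hf.map_eq_of_map_sub_lt hst]
    exact (hf.1 _).trans_lt hst
  refine ⟨s, hs, t, ht, hf.map_sub_lt_trans ?_ hst⟩
  rw [hf.2.2.2.2] at hpt
  rw [← sub_mul, hf.2.2.2.2, hf.2.2.2.2]
  exact mul_lt_mul_of_pos_right h (pos_of_mul_pos_right hpt (hf.1 p))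

theorem dI_le (hf : IsMultNorm f) {S : Set A} {x y ξ : A × A} {r : ℝ} (hξ : ξ.1 ∈ Sat f S)
    (hx : Delta f x ξ ≤ r) (hy : Delta f y ξ ≤ r) : dI f S x y ≤ r := by
  have hbdd : BddBelow {r | ∃ ξ : A × A, ξ.1 ∈ Sat f S ∧ r = max (Delta f x ξ) (Delta f y ξ)} := by
    refine ⟨0, ?_⟩
    rintro _ ⟨η, -, rfl⟩
    exact le_max_of_le_left
      (mul_nonneg (mul_nonneg (inv_nonneg.2 (hf.1 _)) (inv_nonneg.2 (hf.1 _))) (hf.1 _))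
  exact (csInf_le hbdd ⟨ξ, hξ, rfl⟩).trans (max_le hx hy)

theorem exists_of_dI_lt (hf : IsMultNorm f) {S : Set A} (h1S : (1 : A) ∈ S) {x y : A × A} {r : ℝ}
    (h : dI f S x y < r) : ∃ ξ : A × A, ξ.1 ∈ Sat f S ∧ Delta f x ξ < r ∧ Delta f y ξ < r := by
  obtain ⟨_, ⟨ξ, hξ, rfl⟩, hr⟩ := exists_lt_of_csInf_lt
    (s := {r | ∃ ξ : A × A, ξ.1 ∈ Sat f S ∧ r = max (Delta f x ξ) (Delta f y ξ)})
    ⟨_, ((1, 0) : A × A), hf.one_mem_sat h1S, rfl⟩ h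
  exact ⟨ξ, hξ, max_lt_iff.1 hr⟩

end IsMultNorm

namespace IsQuasiAbelian

variable {A : Type*} [Ring A] {f : A → ℝ}

theorem mul_mem_sat (hf : IsQuasiAbelian f) {S : Set A} (hS : ∀ a ∈ S, ∀ b ∈ S, a * b ∈ S)
    {p q : A} (hp : p ∈ Sat f S) (hq : q ∈ Sat f S) : p * q ∈ Sat f S := by
  obtain ⟨hf, γ, -, hγ1, hγ⟩ := hf
  have hmul := hf.2.2.2.2
  obtain ⟨s, hs, t, ht, h⟩ := hp
  obtain ⟨s', hs', t', ht', h'⟩ := hq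
  refine ⟨s * s', hS _ hs _ hs', t * t', hS _ ht _ ht',
    hf.map_sub_lt_trans (y := p * t * (q * t')) ?_ (hf.map_mul_sub_mul_lt h h')⟩
  have hpos : 0 < f p * f t * (f q * f t') := by
    rw [← hmul p, ← hmul q, hf.map_eq_of_map_sub_lt h, hf.map_eq_of_map_sub_lt h']
    exact mul_pos ((hf.1 _).trans_lt h) ((hf.1 _).trans_lt h')
  have key : p * q * (t * t') - p * t * (q * t') = p * (q * t - t * q) * t' := by noncomm_ring
  have hle : f p * f (q * t - t * q) * f t' ≤ f p * (γ * f (q * t)) * f t' :=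
    mul_le_mul_of_nonneg_right (mul_le_mul_of_nonneg_left (hγ q t) (hf.1 _)) (hf.1 _)
  rw [key]
  simp only [hmul] at hle ⊢
  nlinarith

theorem pow_mem_sat (hf : IsQuasiAbelian f) {S : Set A} (h1S : (1 : A) ∈ S)
    (hS : ∀ a ∈ S, ∀ b ∈ S, a * b ∈ S) {p : A} (hp : p ∈ Sat f S) (n : ℕ) : p ^ n ∈ Sat f S := by
  induction n with
  | zero => simpa using hf.1.one_mem_sat h1S
  | succ n ih => rw [pow_succ]; exact hf.mul_mem_sat hS ih hp

/-- An approximate right Ore condition. -/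
theorem exists_map_mul_pow_sub_mul_le (hf : IsQuasiAbelian f) (u v : A) {δ : ℝ} (hδ : 0 < δ) :
    ∃ (n : ℕ) (w : A), f (u * w - v * u ^ n) ≤ δ * f (v * u ^ n) := by
  obtain ⟨hf, γ, hγ0, hγ1, hγ⟩ := hf
  have hmul := hf.2.2.2.2
  have approx : ∀ n : ℕ, ∃ w, f (v * u ^ n - u * w) ≤ γ ^ n * f (v * u ^ n) := by
    intro n
    induction n with
    | zero => exact ⟨0, by simp⟩
    | succ n ih =>
      obtain ⟨w, hw⟩ := ih
      set r := v * u ^ n - u * w with hr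
      refine ⟨w * u + r, ?_⟩
      have key : v * u ^ (n + 1) - u * (w * u + r) = r * u - u * r := by
        rw [hr, pow_succ]; noncomm_ring
      rw [key]
      calc f (r * u - u * r) ≤ γ * (f r * f u) := hmul r u ▸ hγ r u
        _ ≤ γ * (γ ^ n * f (v * u ^ n) * f u) := by
          gcongr
          exact hf.1 u
        _ = γ ^ (n + 1) * f (v * u ^ (n + 1)) := by
          rw [pow_succ u, ← mul_assoc v, hmul (v * u ^ n)]; ring
  obtain ⟨n, hn⟩ := exists_pow_lt_of_lt_one hδ hγ1
  obtain ⟨w, hw⟩ := approx n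
  refine ⟨n, w, ?_⟩
  rw [← hf.map_neg, neg_sub]
  exact hw.trans (mul_le_mul_of_nonneg_right hn.le (hf.1 _))

/-- For a single norm, the level sets of `dI` are stable under addition of numerators. -/
theorem dI_add_le (hf : IsQuasiAbelian f) {S : Set A} (h1S : (1 : A) ∈ S)
    (hS : ∀ a ∈ S, ∀ b ∈ S, a * b ∈ S) {s t a b c d : A} (hs : 0 < f s) (ht : 0 < f t) {ε : ℝ}
    (hε : 0 < ε) (hac : dI f S (s, a) (t, c) ≤ ε) (hbd : dI f S (s, b) (t, d) ≤ ε) :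
    dI f S (s, a + b) (t, c + d) ≤ ε := by
  have hf' := hf.1
  have hmul := hf'.2.2.2.2
  refine le_of_forall_gt_imp_ge_of_dense fun r hr => ?_
  have hr0 : 0 < r := hε.trans hr
  obtain ⟨⟨u, e⟩, hu, hau, hcu⟩ := hf'.exists_of_dI_lt h1S (hac.trans_lt hr)
  obtain ⟨⟨v, g⟩, hv, hbv, hdv⟩ := hf'.exists_of_dI_lt h1S (hbd.trans_lt hr)
  dsimp only at hu hv
  have hu0 := hf'.pos_of_mem_sat hu
  have hv0 := hf'.pos_of_mem_sat hv
  obtain ⟨δ, hδ0, hδ⟩ : ∃ δ > 0, δ < 1 ∧ δ * f b ≤ r * f s ∧ δ * f d ≤ r * f t := by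
    have hb := hf'.1 b
    have hd := hf'.1 d
    have hB : 0 < r * f s / (f b + 1) := by positivity
    have hD : 0 < r * f t / (f d + 1) := by positivity
    refine ⟨min (1 / 2) (min (r * f s / (f b + 1)) (r * f t / (f d + 1))), by positivity,
      (min_le_left _ _).trans_lt (by norm_num), ?_, ?_⟩
    · have h := (min_le_right (1 / 2) _).trans
        (min_le_left (r * f s / (f b + 1)) (r * f t / (f d + 1)))
      refine (mul_le_mul_of_nonneg_right h hb).trans ?_
      have := div_mul_cancel₀ (r * f s) (by positivity : f b + 1 ≠ 0)
      nlinarith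
    · have h := (min_le_right (1 / 2) _).trans
        (min_le_right (r * f s / (f b + 1)) (r * f t / (f d + 1)))
      refine (mul_le_mul_of_nonneg_right h hd).trans ?_
      have := div_mul_cancel₀ (r * f t) (by positivity : f d + 1 ≠ 0)
      nlinarith
  obtain ⟨hδ1, hδb, hδd⟩ := hδ
  obtain ⟨n, w, hw⟩ := hf.exists_map_mul_pow_sub_mul_le u v hδ0
  have hmem : v * u ^ n ∈ Sat f S := hf.mul_mem_sat hS hv (hf.pow_mem_sat h1S hS hu n)
  have hpos := hf'.pos_of_mem_sat hmem
  have hclose : f (u * w - v * u ^ n) < f (v * u ^ n) := hw.trans_lt (by nlinarith)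
  have heq := hf'.map_eq_of_map_sub_lt hclose
  have bound : ∀ {q x y : A}, 0 < f q → Delta f (q, x) (u, e) < r → Delta f (q, y) (v, g) < r →
      δ * f y ≤ r * f q → Delta f (q, x + y) (u * w, e * w + g * u ^ n) ≤ r := by
    intro q x y hq hx hy hδy
    simp only [Delta] at hx hy ⊢
    rw [← mul_inv, inv_mul_lt_iff₀ (mul_pos hq hu0)] at hx
    rw [← mul_inv, inv_mul_lt_iff₀ (mul_pos hq hv0)] at hy
    rw [← mul_inv, inv_mul_le_iff₀ (mul_pos hq (heq ▸ hpos))]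
    have key : (x + y) * (u * w) - q * (e * w + g * u ^ n) =
        (x * u - q * e) * w + ((y * v - q * g) * u ^ n + y * (u * w - v * u ^ n)) := by
      noncomm_ring
    rw [key]
    refine (hf'.2.2.1 _ _).trans (max_le ?_ ((hf'.2.2.1 _ _).trans (max_le ?_ ?_)))
    · rw [hmul, hmul u]
      nlinarith [mul_le_mul_of_nonneg_right hx.le (hf'.1 w)]
    · rw [hmul, heq, hmul v]
      nlinarith [mul_le_mul_of_nonneg_right hy.le (hf'.1 (u ^ n))]
    · rw [hmul, heq]
      nlinarith [mul_le_mul_of_nonneg_left hw (hf'.1 y), mul_le_mul_of_nonneg_right hδy hpos.le]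
  exact hf'.dI_le (ξ := (u * w, e * w + g * u ^ n)) (hf'.mem_sat_of_map_sub_lt hmem hclose)
    (bound hs hau hbv hδb) (bound ht hcu hdv hδd)

end IsQuasiAbelian

theorem statement6 {A : Type*} [Ring A] {m : ℕ} (hm : 0 < m)
    (f : Fin m → A → ℝ) (hf : ∀ i, IsQuasiAbelian (f i))
    (S : Set A) (h1S : (1 : A) ∈ S) (h0S : (0 : A) ∉ S)
    (hS : ∀ a ∈ S, ∀ b ∈ S, a * b ∈ S)
    (ε : ℝ) (hε0 : 0 < ε) (hε1 : ε < 1)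
    (s t : A) (hs : s ∈ S) (ht : t ∈ S) (a b c d : A)
    (hac : dGlob f S (s, a) (t, c) ≤ ε)
    (hbd : dGlob f S (s, b) (t, d) ≤ ε) :
    dGlob f S (s, a + b) (t, c + d) ≤
      ε * ⨆ i : Fin m, max 1 (max ((f i s)⁻¹ * f i a)
        (max ((f i s)⁻¹ * f i b) (max ((f i t)⁻¹ * f i c) ((f i t)⁻¹ * f i d)))) := by
  have hpos : ∀ i, ∀ x ∈ S, 0 < f i x := fun i x hx =>
    ((hf i).1.1 x).lt_of_ne fun h => h0S (((hf i).1.2.1 x).1 h.symm ▸ hx)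
  have : Nonempty (Fin m) := ⟨⟨0, hm⟩⟩
  have hle : ∀ {x y : A × A}, dGlob f S x y ≤ ε → ∀ i, dI (f i) S x y ≤ ε := fun h i =>
    (le_ciSup (Set.finite_range _).bddAbove i).trans h
  refine ciSup_le fun i => ((hf i).dI_add_le h1S hS (hpos i s hs) (hpos i t ht) hε0
    (hle hac i) (hle hbd i)).trans (le_mul_of_one_le_right hε0.le ?_)
  exact le_ciSup_of_le (Set.finite_range _).bddAbove i (le_max_left _ _)
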